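/- Fix an integer k ≥ 2 and let n = kr with r → ∞; let λ = k − 1. Let b = b(n) be a sequence of positive reals with b^{−1}·log^{−2} n = o(1), and set ξ̃ = (E_n^{{0,k}}(B))^b. Then there exist positive constants c₁, c₂ such that for all sufficiently large r: P_n^{{0,k}}(B ≥ ξ̃) < exp(−c₁·(n/λ)^{1/3}/log³(n/λ)); consequently the expected number of independent uniform samples needed to find a mapping f with B(f) ≥ ξ̃, which equals 1/P_n^{{0,k}}(B ≥ ξ̃), exceeds exp(c₁·(n/λ)^{1/3}/log³(n/λ)), and exp(c₂·(n/λ)^{1/3}/log³(n/λ))·P_n^{{0,k}}(B ≥ ξ̃) ≤ exp(−c₂·(n/λ)^{1/3}/log³(n/λ)). -/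

import Mathlib

open Filter Finset Asymptotics MeasureTheory

noncomputable section

open scoped Classical

/-- `f` is a `{0,k}`-mapping: every point has either `0` or `k` preimages. -/
def IsZKMap {n : ℕ} (k : ℕ) (f : Fin n → Fin n) : Prop :=
  ∀ y : Fin n,
    (Finset.univ.filter fun x => f x = y).card = 0 ∨
    (Finset.univ.filter fun x => f x = y).card = k

/-- The finite set of `{0,k}`-mappings on `[n]`. -/
def zkMaps (n k : ℕ) : Finset (Fin n → Fin n) :=
  Finset.univ.filter fun f => IsZKMap k f

/-- The set of cyclic nodes of `f`. -/
def cyclicSet {n : ℕ} (f : Fin n → Fin n) : Finset (Fin n) :=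
  Finset.univ.filter fun x => ∃ m, 0 < m ∧ f^[m] x = x

/-- `Z f`: the number of cyclic nodes of `f`. -/
def Zmap {n : ℕ} (f : Fin n → Fin n) : ℕ := (cyclicSet f).card

/-- The cycles of `f`: the orbits of the cyclic nodes under `f`. -/
def cyclesOf {n : ℕ} (f : Fin n → Fin n) : Finset (Finset (Fin n)) :=
  (cyclicSet f).image fun x => (cyclicSet f).filter fun y => ∃ m, f^[m] x = y

/-- `T f`: the least common multiple of the cycle lengths of `f`. -/
def Tmap {n : ℕ} (f : Fin n → Fin n) : ℕ := (cyclesOf f).lcm Finset.card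

/-- `B f`: the product of the cycle lengths of `f`, counted with multiplicity. -/
def Bmap {n : ℕ} (f : Fin n → Fin n) : ℕ := ∏ c ∈ cyclesOf f, c.card

/-- `C f`: the number of cycles of `f`. -/
def Cmap {n : ℕ} (f : Fin n → Fin n) : ℕ := (cyclesOf f).card

/-- Uniform probability of the event `p` over `{0,k}`-mappings on `[n]`. -/
def zkProb (n k : ℕ) (p : (Fin n → Fin n) → Prop) : ℝ :=
  (((zkMaps n k).filter p).card : ℝ) / ((zkMaps n k).card : ℝ)

/-- Expectation of `X` under the uniform measure on `{0,k}`-mappings on `[n]`. -/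
def zkExp (n k : ℕ) (X : (Fin n → Fin n) → ℝ) : ℝ :=
  (∑ f ∈ zkMaps n k, X f) / ((zkMaps n k).card : ℝ)

/-- The standard normal cumulative distribution function. -/
def stdNormalCDF (x : ℝ) : ℝ :=
  (Real.sqrt (2 * Real.pi))⁻¹ * ∫ t in Set.Iic x, Real.exp (-t ^ 2 / 2)

/-- `M m`: the average order of a uniformly random permutation of `[m]`. -/
def Mperm (m : ℕ) : ℝ :=
  (∑ σ : Equiv.Perm (Fin m), (orderOf σ : ℝ)) / (m.factorial : ℝ)

theorem exists_perm_apply_eq {ι α : Type*} [Fintype α] (x y : ι ↪ α) :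
    ∃ π : Equiv.Perm α, ∀ i, π (x i) = y i := by
  let e : {a // a ∈ Set.range x} ≃ {a // a ∈ Set.range y} :=
    (Equiv.ofInjective x x.injective).symm.trans (Equiv.ofInjective y y.injective)
  refine ⟨e.extendSubtype, fun i => ?_⟩
  rw [Equiv.extendSubtype_apply_of_mem e (x i) ⟨i, rfl⟩]
  change ((Equiv.ofInjective y y.injective ((Equiv.ofInjective x x.injective).symm
    (Equiv.ofInjective x x.injective i)) : Set.range y) : α) = y i
  rw [Equiv.symm_apply_apply, Equiv.ofInjective_apply]

theorem mem_zkMaps {n k : ℕ} {f : Fin n → Fin n} : f ∈ zkMaps n k ↔ IsZKMap k f := by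
  simp [zkMaps]

theorem card_fiber_of_mem_zkMaps {n k : ℕ} {f : Fin n → Fin n} (hf : f ∈ zkMaps n k) (a : Fin n) :
    (univ.filter fun x => f x = f a).card = k :=
  (mem_zkMaps.1 hf (f a)).resolve_left <|
    (card_pos.2 ⟨a, by simp⟩).ne'

theorem perm_comp_mem_zkMaps {n k : ℕ} {f : Fin n → Fin n} (hf : f ∈ zkMaps n k)
    (π : Equiv.Perm (Fin n)) : π ∘ f ∈ zkMaps n k := by
  rw [mem_zkMaps] at hf ⊢
  intro y
  have h : (Finset.univ.filter fun x => (π ∘ f) x = y) =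
      Finset.univ.filter fun x => f x = π.symm y := by
    ext x
    simp [Equiv.eq_symm_apply]
  rw [h]
  exact hf _

section Extensions

variable {n k : ℕ} {ι : Type*} [Fintype ι]

/-- The number of `{0,k}`-mappings extending a partial injection depends only on the domain. -/
theorem card_extensions_eq (x : ι → Fin n) (y y' : ι ↪ Fin n) :
    ((zkMaps n k).filter fun f => f ∘ x = y).card =
      ((zkMaps n k).filter fun f => f ∘ x = y').card := by
  have key : ∀ y y' : ι ↪ Fin n, ((zkMaps n k).filter fun f => f ∘ x = y).card ≤
      ((zkMaps n k).filter fun f => f ∘ x = y').card := by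
    intro y y'
    obtain ⟨π, hπ⟩ := exists_perm_apply_eq y y'
    refine card_le_card_of_injOn (fun f => π ∘ f) ?_ ?_
    · intro f hf
      simp only [coe_filter, Set.mem_ofPred_eq] at hf ⊢
      refine ⟨perm_comp_mem_zkMaps hf.1 π, ?_⟩
      rw [Function.comp_assoc, hf.2]
      exact funext hπ
    · intro f _ g _ h
      exact π.injective.comp_left h
  exact le_antisymm (key y y') (key y' y)

theorem descFactorial_mul_card_extensions (x : ι → Fin n) (y : ι ↪ Fin n) :
    n.descFactorial (Fintype.card ι) * ((zkMaps n k).filter fun f => f ∘ x = y).card =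
      ((zkMaps n k).filter fun f => Function.Injective (f ∘ x)).card := by
  have h : ((zkMaps n k).filter fun f => Function.Injective (f ∘ x)) =
      (univ : Finset (ι ↪ Fin n)).biUnion fun y' => (zkMaps n k).filter fun f => f ∘ x = y' := by
    ext f
    simp only [mem_filter, mem_biUnion, mem_univ, true_and]
    constructor
    · rintro ⟨hf, hi⟩
      exact ⟨⟨f ∘ x, hi⟩, hf, rfl⟩
    · rintro ⟨y', hf, hy⟩
      exact ⟨hf, hy ▸ y'.injective⟩
  rw [h, card_biUnion]
  · rw [sum_congr rfl fun y' _ => card_extensions_eq x y' y, sum_const, card_univ,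
      Fintype.card_embedding_eq, Fintype.card_fin, smul_eq_mul]
  · intro y₁ _ y₂ _ hne
    rw [Function.onFun, Finset.disjoint_left]
    intro f h₁ h₂
    simp only [mem_filter] at h₁ h₂
    exact hne (DFunLike.coe_injective (h₁.2.symm.trans h₂.2))

theorem card_image_of_mem_zkMaps {r : ℕ} (hk : 0 < k) {f : Fin (k * r) → Fin (k * r)}
    (hf : f ∈ zkMaps (k * r) k) : (univ.image f).card = r := by
  have h := card_eq_sum_card_image f univ
  rw [card_univ, Fintype.card_fin, sum_congr rfl (g := fun _ => k), sum_const, smul_eq_mul] at h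
  · exact (Nat.eq_of_mul_eq_mul_right hk ((mul_comm r k).trans h)).symm
  · intro y hy
    obtain ⟨a, -, rfl⟩ := mem_image.1 hy
    exact card_fiber_of_mem_zkMaps hf a

/-- The number of tuples of points with distinct images under a `{0,k}`-mapping. -/
theorem card_injective_comp {r : ℕ} (hk : 0 < k) {f : Fin (k * r) → Fin (k * r)}
    (hf : f ∈ zkMaps (k * r) k) :
    ((univ : Finset (ι → Fin (k * r))).filter fun x => Function.Injective (f ∘ x)).card =
      r.descFactorial (Fintype.card ι) * k ^ Fintype.card ι := by
  have hr := card_image_of_mem_zkMaps hk hf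
  have h : ((univ : Finset (ι → Fin (k * r))).filter fun x => Function.Injective (f ∘ x)) =
      (univ : Finset (ι ↪ (univ.image f : Finset (Fin (k * r))))).biUnion fun y =>
        Fintype.piFinset fun i => univ.filter fun a => f a = y i := by
    ext x
    simp only [mem_filter, mem_univ, true_and, mem_biUnion, Fintype.mem_piFinset]
    constructor
    · intro hi
      refine ⟨⟨fun i => ⟨f (x i), mem_image_of_mem f (mem_univ _)⟩, fun i j hij => ?_⟩,
        fun i => rfl⟩
      exact hi (congrArg Subtype.val hij)
    · rintro ⟨y, hy⟩ i j hij
      apply y.injective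
      apply Subtype.ext
      rw [← hy i, ← hy j]
      exact hij
  rw [h, card_biUnion]
  · rw [sum_congr rfl (g := fun _ => k ^ Fintype.card ι)]
    · rw [sum_const, card_univ, Fintype.card_embedding_eq, Fintype.card_coe, hr, smul_eq_mul]
    · intro y _
      rw [Fintype.card_piFinset, prod_congr rfl (g := fun _ => k), prod_const, card_univ]
      intro i _
      obtain ⟨a, -, ha⟩ := mem_image.1 (y i).2
      rw [← ha]
      exact card_fiber_of_mem_zkMaps hf a
  · intro y₁ _ y₂ _ hne
    rw [Function.onFun, Finset.disjoint_left]
    intro x h₁ h₂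
    simp only [Fintype.mem_piFinset, mem_filter, mem_univ, true_and] at h₁ h₂
    refine hne (DFunLike.ext _ _ fun i => Subtype.ext ?_)
    rw [← h₁ i, ← h₂ i]

/-- The expected number of embedded copies of a permutation `ρ` in a `{0,k}`-mapping. -/
theorem descFactorial_mul_sum_card_conj {r : ℕ} (hk : 0 < k) (ρ : ι ↪ ι) :
    (k * r).descFactorial (Fintype.card ι) * ∑ f ∈ zkMaps (k * r) k,
        (univ.filter fun x : ι ↪ Fin (k * r) => f ∘ x = x ∘ ρ).card =
      (zkMaps (k * r) k).card * (r.descFactorial (Fintype.card ι) * k ^ Fintype.card ι) := by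
  have h₁ : ∑ f ∈ zkMaps (k * r) k,
      (univ.filter fun x : ι ↪ Fin (k * r) => f ∘ x = x ∘ ρ).card =
      ∑ x : ι ↪ Fin (k * r), ((zkMaps (k * r) k).filter fun f => f ∘ x = ρ.trans x).card := by
    simp only [card_filter]
    exact sum_comm
  rw [h₁, mul_sum, sum_congr rfl fun (x : ι ↪ Fin (k * r)) _ =>
    descFactorial_mul_card_extensions (k := k) x (ρ.trans x)]
  simp only [card_filter]
  rw [sum_comm]
  refine sum_eq_card_nsmul fun f hf => ?_
  rw [← card_injective_comp hk hf, ← card_filter]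
  refine card_bij (fun x _ => x) ?_ ?_ ?_
  · intro x hx
    simpa using hx
  · intro x _ y _ h
    exact DFunLike.coe_injective h
  · intro x hx
    simp only [mem_filter, mem_univ, true_and] at hx
    exact ⟨⟨x, hx.of_comp⟩, by simpa using hx, rfl⟩

end Extensions

theorem zkMaps_nonempty {k : ℕ} (hk : 0 < k) (r : ℕ) : (zkMaps (k * r) k).Nonempty := by
  let f : Fin (k * r) → Fin (k * r) := fun x =>
    ⟨x / k, (Nat.div_le_self _ _).trans_lt x.2⟩
  refine ⟨f, mem_zkMaps.2 ?_⟩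
  intro y
  by_cases hy : (y : ℕ) < r
  · right
    have hb : ∀ j < k, k * (y : ℕ) + j < k * r := fun j hj => by nlinarith
    refine (card_nbij' (t := range k) (fun x : Fin (k * r) => (x : ℕ) % k)
      (fun j => if h : j < k then (⟨k * y + j, hb j h⟩ : Fin (k * r)) else y) ?_ ?_ ?_ ?_).trans (card_range k)
    · intro x _
      simpa using Nat.mod_lt _ hk
    · intro j hj
      have hj' : j < k := by simpa using hj
      simp [hj', f, Fin.ext_iff, Nat.mul_add_div hk, Nat.div_eq_of_lt hj']
    · intro x hx
      have hx' : (x : ℕ) / k = y := by simpa [f, Fin.ext_iff] using hx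
      simp [Nat.mod_lt _ hk, ← hx', Nat.div_add_mod]
    · intro j hj
      have hj' : j < k := by simpa using hj
      simp [hj', Nat.mod_eq_of_lt hj']
  · left
    rw [card_eq_zero, filter_eq_empty_iff]
    intro x _ h
    apply hy
    rw [← h]
    exact Nat.div_lt_of_lt_mul x.2

section Cycles

variable {n : ℕ} {f : Fin n → Fin n}

theorem mem_cyclicSet {x : Fin n} : x ∈ cyclicSet f ↔ ∃ m, 0 < m ∧ f^[m] x = x := by
  simp [cyclicSet]

theorem iterate_mem_cyclicSet {x : Fin n} (hx : x ∈ cyclicSet f) (j : ℕ) :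
    f^[j] x ∈ cyclicSet f := by
  obtain ⟨m, hm, h⟩ := mem_cyclicSet.1 hx
  refine mem_cyclicSet.2 ⟨m, hm, ?_⟩
  rw [← Function.iterate_add_apply, add_comm, Function.iterate_add_apply, h]

theorem exists_iterate_iterate_eq {x : Fin n} (hx : x ∈ cyclicSet f) (j : ℕ) :
    ∃ i, f^[i] (f^[j] x) = x := by
  obtain ⟨m, hm, h⟩ := mem_cyclicSet.1 hx
  refine ⟨m * j - j, ?_⟩
  rw [← Function.iterate_add_apply, Nat.sub_add_cancel (Nat.le_mul_of_pos_left j hm),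
    Function.iterate_mul]
  exact Function.iterate_fixed h j

/-- The cycle of `f` through `x`. -/
def cycleThrough (f : Fin n → Fin n) (x : Fin n) : Finset (Fin n) :=
  (cyclicSet f).filter fun y => ∃ m, f^[m] x = y

theorem mem_cycleThrough {x y : Fin n} (hx : x ∈ cyclicSet f) :
    y ∈ cycleThrough f x ↔ ∃ m, f^[m] x = y := by
  simp only [cycleThrough, mem_filter, and_iff_right_iff_imp]
  rintro ⟨m, rfl⟩
  exact iterate_mem_cyclicSet hx m

theorem mem_cyclesOf {c : Finset (Fin n)} :
    c ∈ cyclesOf f ↔ ∃ x ∈ cyclicSet f, cycleThrough f x = c := by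
  simp [cyclesOf, cycleThrough]

theorem self_mem_cycleThrough {x : Fin n} (hx : x ∈ cyclicSet f) : x ∈ cycleThrough f x :=
  (mem_cycleThrough hx).2 ⟨0, rfl⟩

theorem cycleThrough_iterate {x : Fin n} (hx : x ∈ cyclicSet f) (j : ℕ) :
    cycleThrough f (f^[j] x) = cycleThrough f x := by
  ext y
  rw [mem_cycleThrough hx, mem_cycleThrough (iterate_mem_cyclicSet hx j)]
  constructor
  · rintro ⟨m, rfl⟩
    exact ⟨m + j, Function.iterate_add_apply f m j x⟩
  · rintro ⟨m, rfl⟩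
    obtain ⟨i, hi⟩ := exists_iterate_iterate_eq hx j
    exact ⟨m + i, by rw [Function.iterate_add_apply, hi]⟩

theorem mem_cyclicSet_of_mem_cycle {c : Finset (Fin n)} (hc : c ∈ cyclesOf f) {y : Fin n}
    (hy : y ∈ c) : y ∈ cyclicSet f := by
  obtain ⟨x, hx, rfl⟩ := mem_cyclesOf.1 hc
  exact (mem_filter.1 hy).1

theorem eq_cycleThrough {c : Finset (Fin n)} (hc : c ∈ cyclesOf f) {y : Fin n} (hy : y ∈ c) :
    c = cycleThrough f y := by
  obtain ⟨x, hx, rfl⟩ := mem_cyclesOf.1 hc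
  obtain ⟨m, rfl⟩ := (mem_cycleThrough hx).1 hy
  exact (cycleThrough_iterate hx m).symm

theorem nonempty_of_mem_cyclesOf {c : Finset (Fin n)} (hc : c ∈ cyclesOf f) : c.Nonempty := by
  obtain ⟨x, hx, rfl⟩ := mem_cyclesOf.1 hc
  exact ⟨x, self_mem_cycleThrough hx⟩

theorem iterate_mem_cycle {c : Finset (Fin n)} (hc : c ∈ cyclesOf f) {y : Fin n} (hy : y ∈ c)
    (j : ℕ) : f^[j] y ∈ c := by
  rw [eq_cycleThrough hc hy, mem_cycleThrough (mem_cyclicSet_of_mem_cycle hc hy)]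
  exact ⟨j, rfl⟩

theorem image_cycle {c : Finset (Fin n)} (hc : c ∈ cyclesOf f) : c.image f = c := by
  ext y
  rw [mem_image]
  constructor
  · rintro ⟨x, hx, rfl⟩
    exact iterate_mem_cycle hc hx 1
  · intro hy
    obtain ⟨m, hm, h⟩ := mem_cyclicSet.1 (mem_cyclicSet_of_mem_cycle hc hy)
    refine ⟨f^[m - 1] y, iterate_mem_cycle hc hy _, ?_⟩
    rw [← Function.iterate_succ_apply' f, Nat.succ_eq_add_one, Nat.sub_add_cancel hm, h]

/-- Unions of cycles are invariant sets, and distinct sets of cycles have distinct unions. -/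
theorem two_pow_Cmap_le (f : Fin n → Fin n) :
    2 ^ Cmap f ≤ ((univ : Finset (Finset (Fin n))).filter fun S => S.image f = S).card := by
  rw [Cmap, ← card_powerset]
  refine card_le_card_of_injOn (fun 𝒞 => 𝒞.biUnion id) ?_ ?_
  · intro 𝒞 h𝒞
    have h𝒞' : 𝒞 ⊆ cyclesOf f := by simpa using h𝒞
    simp only [coe_filter, mem_univ, true_and, Set.mem_ofPred_eq]
    rw [biUnion_image]
    exact biUnion_congr rfl fun c hc => image_cycle (h𝒞' hc)
  · have key : ∀ 𝒞 𝒟 : Finset (Finset (Fin n)), 𝒞 ⊆ cyclesOf f → 𝒟 ⊆ cyclesOf f →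
        𝒞.biUnion id = 𝒟.biUnion id → 𝒞 ⊆ 𝒟 := by
      intro 𝒞 𝒟 h𝒞 h𝒟 h c hc
      obtain ⟨x, hx⟩ := nonempty_of_mem_cyclesOf (h𝒞 hc)
      have hx' : x ∈ 𝒟.biUnion id := h ▸ mem_biUnion.2 ⟨c, hc, hx⟩
      obtain ⟨d, hd, hxd⟩ := mem_biUnion.1 hx'
      rw [eq_cycleThrough (h𝒞 hc) hx, ← eq_cycleThrough (h𝒟 hd) hxd]
      exact hd
    intro 𝒞 h𝒞 𝒟 h𝒟 h
    have h𝒞' : 𝒞 ⊆ cyclesOf f := by simpa using h𝒞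
    have h𝒟' : 𝒟 ⊆ cyclesOf f := by simpa using h𝒟
    exact (key _ _ h𝒞' h𝒟' h).antisymm (key _ _ h𝒟' h𝒞' h.symm)

theorem Bmap_le_pow (f : Fin n → Fin n) : Bmap f ≤ n ^ Cmap f := by
  rw [Bmap, Cmap]
  refine prod_le_pow_card _ _ _ fun c _ => ?_
  simpa using card_le_univ c

end Cycles

theorem choose_mul_card_invariant_le {n k : ℕ} (S : Finset (Fin n)) :
    n.choose S.card * ((zkMaps n k).filter fun f => S.image f = S).card ≤ (zkMaps n k).card := by
  let v : S ↪ Fin n := Function.Embedding.subtype _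
  have hsub : ((zkMaps n k).filter fun f => S.image f = S) ⊆
      (univ : Finset (Equiv.Perm S)).biUnion fun σ =>
        (zkMaps n k).filter fun f => f ∘ v = σ.toEmbedding.trans v := by
    intro f hf
    obtain ⟨hf, hS⟩ := mem_filter.1 hf
    have hmem : ∀ a : S, f a ∈ S := fun a => hS.subset (mem_image_of_mem f a.2)
    have hsurj : Function.Surjective fun a : S => (⟨f a, hmem a⟩ : S) := by
      intro b
      have hb : (b : Fin n) ∈ S.image f := by rw [hS]; exact b.2
      obtain ⟨a, ha, hab⟩ := mem_image.1 hb
      exact ⟨⟨a, ha⟩, Subtype.ext hab⟩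
    simp only [mem_biUnion, mem_univ, true_and, mem_filter]
    exact ⟨Equiv.ofBijective _ (Finite.surjective_iff_bijective.1 hsurj), hf, rfl⟩
  have hcard := (card_le_card hsub).trans card_biUnion_le
  rw [sum_congr rfl fun σ _ => card_extensions_eq (k := k) v (σ.toEmbedding.trans v) v,
    sum_const, card_univ, Fintype.card_perm, Fintype.card_coe, smul_eq_mul] at hcard
  calc n.choose S.card * ((zkMaps n k).filter fun f => S.image f = S).card
      ≤ n.choose S.card * (S.card.factorial *
          ((zkMaps n k).filter fun f => f ∘ v = v).card) := Nat.mul_le_mul_left _ hcard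
    _ = n.descFactorial (Fintype.card S) * ((zkMaps n k).filter fun f => f ∘ v = v).card := by
        rw [Fintype.card_coe, Nat.descFactorial_eq_factorial_mul_choose]; ring
    _ ≤ (zkMaps n k).card := by
        rw [descFactorial_mul_card_extensions]; exact card_filter_le _ _

/-- The mean of `2 ^ C` is at most `n + 1`. -/
theorem sum_two_pow_Cmap_le (n k : ℕ) :
    ∑ f ∈ zkMaps n k, (2 : ℝ) ^ Cmap f ≤ (n + 1) * (zkMaps n k).card := by
  have h₁ : ∑ f ∈ zkMaps n k, (2 : ℝ) ^ Cmap f ≤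
      ∑ S : Finset (Fin n), (((zkMaps n k).filter fun f => S.image f = S).card : ℝ) := by
    have : ∑ f ∈ zkMaps n k, 2 ^ Cmap f ≤
        ∑ S : Finset (Fin n), ((zkMaps n k).filter fun f => S.image f = S).card := by
      refine (sum_le_sum fun f _ => two_pow_Cmap_le f).trans_eq ?_
      simp only [card_filter]
      exact sum_comm
    exact_mod_cast this
  refine h₁.trans ?_
  have h₂ : ∀ S : Finset (Fin n), (((zkMaps n k).filter fun f => S.image f = S).card : ℝ) ≤
      (n.choose S.card : ℝ)⁻¹ * (zkMaps n k).card := by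
    intro S
    have hpos : (0 : ℝ) < n.choose S.card := by
      exact_mod_cast Nat.choose_pos (by simpa using card_le_univ S)
    rw [le_inv_mul_iff₀ hpos]
    exact_mod_cast choose_mul_card_invariant_le S
  refine (sum_le_sum fun S _ => h₂ S).trans_eq ?_
  rw [← sum_mul]
  congr 1
  rw [← powerset_univ, sum_powerset_apply_card (fun j => (n.choose j : ℝ)⁻¹)]
  rw [card_univ, Fintype.card_fin, sum_congr rfl (g := fun _ => (1 : ℝ))]
  · simp
  · intro j hj
    have : (n.choose j : ℝ) ≠ 0 := by
      exact_mod_cast (Nat.choose_pos (Nat.lt_succ_iff.1 (mem_range.1 hj))).ne'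
    rw [nsmul_eq_mul, mul_inv_cancel₀ this]

theorem sum_embedding_prod_le {α : Type*} [Fintype α] (m : ℕ) (u : α → ℕ) :
    ∑ c : Fin m ↪ α, ∏ i, u (c i) ≤ m.factorial * ∏ a, (1 + u a) := by
  have hfiber : ∀ T : Finset α,
      ((univ : Finset (Fin m ↪ α)).filter fun c : Fin m ↪ α => univ.map c = T).card ≤
        m.factorial := by
    intro T
    rcases ((univ : Finset (Fin m ↪ α)).filter fun c : Fin m ↪ α => univ.map c = T).eq_empty_or_nonempty
      with h | ⟨c₀, hc₀⟩
    · simp [h]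
    · have hT : T.card = m := by
        rw [← (mem_filter.1 hc₀).2, card_map, card_univ, Fintype.card_fin]
      have hcard : Fintype.card (Fin m ↪ T) = m.factorial := by
        rw [Fintype.card_embedding_eq, Fintype.card_coe, Fintype.card_fin, hT,
          Nat.descFactorial_self]
      rw [← hcard, ← card_univ]
      refine card_le_card_of_surjOn (fun d => d.trans (Function.Embedding.subtype _)) ?_
      intro c hc
      have hc' : univ.map c = T := by simpa using hc
      refine ⟨⟨fun i => ⟨c i, hc' ▸ mem_map_of_mem c (mem_univ i)⟩, fun i j hij => ?_⟩, by simp, ?_⟩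
      · exact c.injective (congrArg Subtype.val hij)
      · rfl
  calc ∑ c : Fin m ↪ α, ∏ i, u (c i)
      = ∑ c : Fin m ↪ α, ∏ a ∈ univ.map c, u a := by simp only [prod_map]
    _ = ∑ T : Finset α, ∑ c : Fin m ↪ α with univ.map c = T, ∏ a ∈ univ.map c, u a :=
        (sum_fiberwise _ _ _).symm
    _ ≤ ∑ T : Finset α, m.factorial * ∏ a ∈ T, u a := by
        refine sum_le_sum fun T _ => ?_
        rw [sum_congr rfl (g := fun _ => ∏ a ∈ T, u a), sum_const, smul_eq_mul]
        · exact Nat.mul_le_mul_right _ (hfiber T)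
        · intro c hc
          rw [(mem_filter.1 hc).2]
    _ = m.factorial * ∏ a, (1 + u a) := by
        rw [← mul_sum, prod_one_add, powerset_univ]

section MarkedCycles

variable {n m : ℕ} {f : Fin n → Fin n}

/-- Tuples of points lying on distinct cycles, none of which is a fixed point. -/
def markedCycles (f : Fin n → Fin n) (m : ℕ) : Finset (Fin m → Fin n) :=
  univ.filter fun p => (∀ i, p i ∈ cyclicSet f ∧ 2 ≤ (cycleThrough f (p i)).card) ∧
    Function.Injective fun i => cycleThrough f (p i)

theorem card_markedCycles_le (f : Fin n → Fin n) (m : ℕ) :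
    (markedCycles f m).card ≤ 2 ^ m * m.factorial * Bmap f := by
  let A := (cyclesOf f).filter fun c => 2 ≤ c.card
  have hsub : markedCycles f m ⊆ (univ : Finset (Fin m ↪ A)).biUnion fun c =>
      Fintype.piFinset fun i => (c i : Finset (Fin n)) := by
    intro p hp
    obtain ⟨hp, hinj⟩ := (mem_filter.1 hp).2
    simp only [mem_biUnion, mem_univ, true_and, Fintype.mem_piFinset]
    refine ⟨⟨fun i => ⟨cycleThrough f (p i), mem_filter.2 ⟨mem_cyclesOf.2 ⟨_, (hp i).1, rfl⟩,
      (hp i).2⟩⟩, fun i j hij => hinj (congrArg Subtype.val hij)⟩, fun i => ?_⟩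
    exact self_mem_cycleThrough (hp i).1
  calc (markedCycles f m).card
      ≤ ∑ c : Fin m ↪ A, ∏ i, (c i : Finset (Fin n)).card := by
        refine (card_le_card hsub).trans (card_biUnion_le.trans_eq ?_)
        simp only [Fintype.card_piFinset]
    _ ≤ ∑ c : Fin m ↪ A, ∏ i, 2 * ((c i : Finset (Fin n)).card - 1) := by
        refine sum_le_sum fun c _ => prod_le_prod' fun i _ => ?_
        have := (mem_filter.1 (c i).2).2
        omega
    _ = 2 ^ m * ∑ c : Fin m ↪ A, ∏ i, ((c i : Finset (Fin n)).card - 1) := by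
        simp only [prod_mul_distrib, prod_const, card_univ, Fintype.card_fin, mul_sum]
    _ ≤ 2 ^ m * (m.factorial * ∏ a : A, (1 + ((a : Finset (Fin n)).card - 1))) :=
        Nat.mul_le_mul_left _ (sum_embedding_prod_le m fun a : A => (a : Finset (Fin n)).card - 1)
    _ = 2 ^ m * m.factorial * ∏ c ∈ A, (1 + (c.card - 1)) := by
        rw [mul_assoc, ← prod_coe_sort A fun c => 1 + (c.card - 1)]
    _ ≤ 2 ^ m * m.factorial * Bmap f := by
        refine Nat.mul_le_mul_left _ ?_
        rw [Bmap, prod_congr rfl (g := card)]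
        · refine prod_le_prod_of_subset_of_one_le' (filter_subset _ _) fun c hc _ => ?_
          exact card_pos.2 (nonempty_of_mem_cyclesOf hc)
        · intro c hc
          have := (mem_filter.1 hc).2
          omega

/-- The permutation with one cycle of length `L i + 2` for each `i`. -/
def blockRotation (L : Fin m → ℕ) : Equiv.Perm (Σ i, Fin (L i + 2)) :=
  Equiv.sigmaCongrRight fun _ => Equiv.addRight 1

section Blocks

variable {L : Fin m → ℕ} {x : (Σ i, Fin (L i + 2)) → Fin n}

theorem apply_block (hx : f ∘ x = x ∘ blockRotation L)
    (i : Fin m) (a : Fin (L i + 2)) : f (x ⟨i, a⟩) = x ⟨i, a + 1⟩ :=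
  congrFun hx ⟨i, a⟩

theorem exists_iterate_eq_block (hx : f ∘ x = x ∘ blockRotation L)
    (i : Fin m) (a : Fin (L i + 2)) :
    ∃ j, f^[j] (x ⟨i, 0⟩) = x ⟨i, a⟩ := by
  induction a using Fin.induction with
  | zero => exact ⟨0, rfl⟩
  | succ a ih =>
    obtain ⟨j, hj⟩ := ih
    exact ⟨j + 1, by rw [Function.iterate_succ_apply', hj, apply_block hx, Fin.coeSucc_eq_succ]⟩

theorem exists_block_eq_iterate (hx : f ∘ x = x ∘ blockRotation L)
    (i : Fin m) (j : ℕ) :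
    ∃ a, f^[j] (x ⟨i, 0⟩) = x ⟨i, a⟩ := by
  induction j with
  | zero => exact ⟨0, rfl⟩
  | succ j ih =>
    obtain ⟨a, ha⟩ := ih
    exact ⟨a + 1, by rw [Function.iterate_succ_apply', ha, apply_block hx]⟩

theorem block_mem_cyclicSet (hx : f ∘ x = x ∘ blockRotation L)
    (i : Fin m) : x ⟨i, 0⟩ ∈ cyclicSet f := by
  obtain ⟨j, hj⟩ := exists_iterate_eq_block hx i (Fin.last _)
  exact mem_cyclicSet.2 ⟨j + 1, j.succ_pos, by
    rw [Function.iterate_succ_apply', hj, apply_block hx, Fin.last_add_one]⟩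

theorem cycleThrough_block (hx : f ∘ x = x ∘ blockRotation L)
    (i : Fin m) :
    cycleThrough f (x ⟨i, 0⟩) = univ.image fun a => x ⟨i, a⟩ := by
  ext y
  simp only [mem_cycleThrough (block_mem_cyclicSet hx i), mem_image, mem_univ, true_and]
  constructor
  · rintro ⟨j, rfl⟩
    obtain ⟨a, ha⟩ := exists_block_eq_iterate hx i j
    exact ⟨a, ha.symm⟩
  · rintro ⟨a, rfl⟩
    exact exists_iterate_eq_block hx i a

theorem card_cycleThrough_block (hx : f ∘ x = x ∘ blockRotation L)
    (hinj : Function.Injective x) (i : Fin m) :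
    (cycleThrough f (x ⟨i, 0⟩)).card = L i + 2 := by
  rw [cycleThrough_block hx, card_image_of_injective, card_univ, Fintype.card_fin]
  exact hinj.comp sigma_mk_injective

theorem block_mem_markedCycles (hx : f ∘ x = x ∘ blockRotation L)
    (hinj : Function.Injective x) :
    (fun i => x ⟨i, 0⟩) ∈ markedCycles f m := by
  refine mem_filter.2 ⟨mem_univ _, fun i => ⟨block_mem_cyclicSet hx i, ?_⟩, fun i j hij => ?_⟩
  · rw [card_cycleThrough_block hx hinj]
    omega
  · have hmem : x ⟨i, 0⟩ ∈ cycleThrough f (x ⟨j, 0⟩) := by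
      have h := self_mem_cycleThrough (block_mem_cyclicSet hx i)
      rwa [show cycleThrough f (x ⟨i, 0⟩) = cycleThrough f (x ⟨j, 0⟩) from hij] at h
    rw [cycleThrough_block hx, mem_image] at hmem
    obtain ⟨a, -, ha⟩ := hmem
    exact (congrArg Sigma.fst (hinj ha)).symm

theorem block_ext (hx : f ∘ x = x ∘ blockRotation L)
    {y : (Σ i, Fin (L i + 2)) → Fin n} (hy : f ∘ y = y ∘ blockRotation L)
    (h : ∀ i, x ⟨i, 0⟩ = y ⟨i, 0⟩) : x = y := by
  funext ⟨i, a⟩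
  induction a using Fin.induction with
  | zero => exact h i
  | succ a ih => rw [← Fin.coeSucc_eq_succ, ← apply_block hx, ← apply_block hy, ih]

end Blocks

theorem sum_card_blocks_le (f : Fin n → Fin n) (m l : ℕ) :
    ∑ L : Fin m → Fin l, (univ.filter fun x : (Σ i, Fin ((L i : ℕ) + 2)) ↪ Fin n =>
      f ∘ x = x ∘ blockRotation fun i => (L i : ℕ)).card ≤ (markedCycles f m).card := by
  rw [← card_sigma]
  refine card_le_card_of_injOn (fun q i => q.2 ⟨i, 0⟩) ?_ ?_
  · intro q hq
    have hq' := (mem_filter.1 (mem_sigma.1 hq).2).2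
    exact block_mem_markedCycles hq' q.2.injective
  · rintro ⟨L, x⟩ hx ⟨L', y⟩ hy h
    have hx' := (mem_filter.1 (mem_sigma.1 hx).2).2
    have hy' := (mem_filter.1 (mem_sigma.1 hy).2).2
    have h0 : ∀ i, x ⟨i, 0⟩ = y ⟨i, 0⟩ := congrFun h
    obtain rfl : L = L' := by
      funext i
      have h₁ := card_cycleThrough_block hx' x.injective i
      have h₂ := card_cycleThrough_block hy' y.injective i
      dsimp only at h₁ h₂
      rw [h0 i, h₂] at h₁
      exact Fin.ext (by omega)
    obtain rfl : x = y := DFunLike.coe_injective (block_ext hx' hy' h0)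
    rfl

end MarkedCycles

theorem card_mul_pow_le_sum_card_conj {ι : Type*} [Fintype ι] {k r Z : ℕ} (hk : 0 < k)
    (hr : 0 < r) (ρ : ι ↪ ι) (hι : Fintype.card ι ≤ Z) (hZ : Z ≤ r) :
    ((zkMaps (k * r) k).card : ℝ) * (1 - (Z : ℝ) / r) ^ Z ≤
      ∑ f ∈ zkMaps (k * r) k,
        ((univ.filter fun x : ι ↪ Fin (k * r) => f ∘ x = x ∘ ρ).card : ℝ) := by
  set z := Fintype.card ι
  set S := ∑ f ∈ zkMaps (k * r) k,
    (univ.filter fun x : ι ↪ Fin (k * r) => f ∘ x = x ∘ ρ).card with hS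
  have hr' : (0 : ℝ) < r := by exact_mod_cast hr
  have hk' : (0 : ℝ) < k := by exact_mod_cast hk
  have h₁ : (zkMaps (k * r) k).card * ((r - z) ^ z * k ^ z) ≤ (k * r) ^ z * S := by
    calc (zkMaps (k * r) k).card * ((r - z) ^ z * k ^ z)
        ≤ (zkMaps (k * r) k).card * (r.descFactorial z * k ^ z) := by
          gcongr
          exact (Nat.pow_le_pow_left (by omega) z).trans (Nat.pow_sub_le_descFactorial r z)
      _ = (k * r).descFactorial z * S := (descFactorial_mul_sum_card_conj hk ρ).symm
      _ ≤ (k * r) ^ z * S := by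
          gcongr
          exact Nat.descFactorial_le_pow _ _
  have h₂ : ((zkMaps (k * r) k).card : ℝ) * (((r : ℝ) - z) ^ z * (k : ℝ) ^ z) ≤
      ((k : ℝ) * r) ^ z * S := by
    rw [← Nat.cast_sub (hι.trans hZ)]
    exact_mod_cast h₁
  have h₃ : ((zkMaps (k * r) k).card : ℝ) * (1 - (z : ℝ) / r) ^ z ≤ S := by
    rw [← mul_le_mul_iff_right₀ (show (0 : ℝ) < ((k : ℝ) * r) ^ z by positivity)]
    refine (Eq.le ?_).trans h₂
    rw [one_sub_div hr'.ne', div_pow, mul_pow]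
    field_simp
  have hzZ : (z : ℝ) ≤ Z := by exact_mod_cast hι
  have hZr : (Z : ℝ) / r ≤ 1 := (div_le_one hr').2 (by exact_mod_cast hZ)
  have h₄ : (1 - (Z : ℝ) / r) ^ Z ≤ (1 - (z : ℝ) / r) ^ z := by
    calc (1 - (Z : ℝ) / r) ^ Z ≤ (1 - (Z : ℝ) / r) ^ z :=
          pow_le_pow_of_le_one (by linarith) (by linarith [show (0 : ℝ) ≤ Z / r by positivity]) hι
      _ ≤ (1 - (z : ℝ) / r) ^ z := by gcongr
  have hS' : (S : ℝ) = ∑ f ∈ zkMaps (k * r) k,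
      ((univ.filter fun x : ι ↪ Fin (k * r) => f ∘ x = x ∘ ρ).card : ℝ) := by
    rw [hS]; push_cast; rfl
  rw [← hS']
  exact (mul_le_mul_of_nonneg_left h₄ (Nat.cast_nonneg _)).trans h₃

theorem pow_mul_pow_le_zkExp_Bmap {k r m l : ℕ} (hk : 0 < k) (hr : 0 < r)
    (hZ : m * (l + 1) ≤ r) :
    (l : ℝ) ^ m * (1 - ((m * (l + 1) : ℕ) : ℝ) / r) ^ (m * (l + 1)) ≤
      2 ^ m * m.factorial * zkExp (k * r) k fun g => (Bmap g : ℝ) := by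
  have hcard : (0 : ℝ) < (zkMaps (k * r) k).card := by
    exact_mod_cast card_pos.2 (zkMaps_nonempty hk r)
  have h₁ : ∀ L : Fin m → Fin l, ((zkMaps (k * r) k).card : ℝ) *
      (1 - ((m * (l + 1) : ℕ) : ℝ) / r) ^ (m * (l + 1)) ≤ ∑ f ∈ zkMaps (k * r) k,
        ((univ.filter fun x : (Σ i, Fin ((L i : ℕ) + 2)) ↪ Fin (k * r) =>
          f ∘ x = x ∘ blockRotation fun i => (L i : ℕ)).card : ℝ) := by
    intro L
    refine card_mul_pow_le_sum_card_conj hk hr (blockRotation fun i => (L i : ℕ)).toEmbedding ?_ hZ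
    rw [Fintype.card_sigma]
    simp only [Fintype.card_fin]
    refine (sum_le_card_nsmul univ _ (l + 1) fun i _ => ?_).trans_eq ?_
    · have := (L i).2
      omega
    · simp
  have h₂ := sum_le_sum fun L (_ : L ∈ (univ : Finset (Fin m → Fin l))) => h₁ L
  rw [sum_const, card_univ, Fintype.card_fun, Fintype.card_fin, Fintype.card_fin, sum_comm,
    nsmul_eq_mul] at h₂
  have h₃ : ∀ f : Fin (k * r) → Fin (k * r), ∑ L : Fin m → Fin l,
      ((univ.filter fun x : (Σ i, Fin ((L i : ℕ) + 2)) ↪ Fin (k * r) =>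
        f ∘ x = x ∘ blockRotation fun i => (L i : ℕ)).card : ℝ) ≤
      2 ^ m * m.factorial * Bmap f := by
    intro f
    exact_mod_cast (sum_card_blocks_le f m l).trans (card_markedCycles_le f m)
  have h₄ := h₂.trans (sum_le_sum fun f _ => h₃ f)
  rw [← mul_sum] at h₄
  rw [zkExp, mul_div_assoc', le_div_iff₀ hcard]
  refine (Eq.le ?_).trans h₄
  push_cast
  ring

theorem exp_neg_two_mul_le_one_sub {u : ℝ} (h₀ : 0 ≤ u) (h₁ : u ≤ 1 / 2) :
    Real.exp (-(2 * u)) ≤ 1 - u := by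
  rw [Real.exp_neg, inv_le_comm₀ (Real.exp_pos _) (by linarith)]
  refine le_trans ?_ (Real.add_one_le_exp (2 * u))
  rw [inv_le_iff_one_le_mul₀ (by linarith)]
  nlinarith

theorem exp_half_le_zkExp_Bmap {k r m : ℕ} (hk : 0 < k) (hm : 1 ≤ m) (h : (8 * m) ^ 3 ≤ r) :
    Real.exp (m / 2) ≤ zkExp (k * r) k fun g => (Bmap g : ℝ) := by
  set Z := m * (6 * m + 1) with hZdef
  set E := zkExp (k * r) k fun g => (Bmap g : ℝ)
  have hZ7 : Z ≤ 7 * m ^ 2 := by rw [hZdef]; nlinarith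
  have h2Z : 2 * Z ≤ r := by nlinarith
  have hr : 0 < r := lt_of_lt_of_le (by positivity) h
  have hr' : (0 : ℝ) < r := by exact_mod_cast hr
  have hm' : (0 : ℝ) < m := by exact_mod_cast hm
  have hmain : ((6 * m : ℕ) : ℝ) ^ m * (1 - (Z : ℝ) / r) ^ Z ≤ 2 ^ m * m.factorial * E :=
    pow_mul_pow_le_zkExp_Bmap hk hr (show m * (6 * m + 1) ≤ r by omega)
  have hexp : Real.exp (-(m / 2 : ℝ)) ≤ (1 - (Z : ℝ) / r) ^ Z := by
    have hu : (Z : ℝ) / r ≤ 1 / 2 := by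
      rw [div_le_div_iff₀ hr' two_pos]
      have : (2 : ℝ) * Z ≤ r := by exact_mod_cast h2Z
      linarith
    refine le_trans ?_ (pow_le_pow_left₀ (Real.exp_pos _).le
      (exp_neg_two_mul_le_one_sub (by positivity) hu) Z)
    rw [← Real.exp_nat_mul, Real.exp_le_exp]
    have h4 : 4 * Z ^ 2 ≤ m * r := by
      calc 4 * Z ^ 2 ≤ 4 * (7 * m ^ 2) ^ 2 := by gcongr
        _ ≤ m * (8 * m) ^ 3 := by ring_nf; gcongr; norm_num
        _ ≤ m * r := by gcongr
    have h4' : (4 : ℝ) * (Z : ℝ) ^ 2 ≤ m * r := by exact_mod_cast h4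
    have : (Z : ℝ) * (2 * (Z / r)) ≤ m / 2 := by
      rw [show (Z : ℝ) * (2 * (Z / r)) = 2 * (Z : ℝ) ^ 2 / r by ring, div_le_iff₀ hr']
      linarith
    linarith
  have hE : 0 ≤ E := div_nonneg (sum_nonneg fun _ _ => Nat.cast_nonneg _) (Nat.cast_nonneg _)
  have hfact : (m.factorial : ℝ) ≤ (m : ℝ) ^ m := by exact_mod_cast Nat.factorial_le_pow m
  have h3 : (3 : ℝ) ^ m * Real.exp (-(m / 2 : ℝ)) ≤ E := by
    refine le_of_mul_le_mul_left ?_ (show (0 : ℝ) < 2 ^ m * (m : ℝ) ^ m by positivity)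
    calc (2 : ℝ) ^ m * (m : ℝ) ^ m * (3 ^ m * Real.exp (-(m / 2 : ℝ)))
        = ((6 * m : ℕ) : ℝ) ^ m * Real.exp (-(m / 2 : ℝ)) := by
          push_cast
          rw [show (6 : ℝ) * m = 2 * m * 3 by ring, mul_pow, mul_pow]
          ring
      _ ≤ ((6 * m : ℕ) : ℝ) ^ m * (1 - (Z : ℝ) / r) ^ Z := by gcongr
      _ ≤ 2 ^ m * m.factorial * E := hmain
      _ ≤ 2 ^ m * (m : ℝ) ^ m * E := by gcongr
  refine le_trans ?_ h3
  have he : Real.exp m ≤ 3 ^ m := by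
    rw [← Real.exp_one_pow]
    exact pow_le_pow_left₀ (Real.exp_pos _).le Real.exp_one_lt_three.le m
  calc Real.exp (m / 2) = Real.exp m * Real.exp (-(m / 2)) := by rw [← Real.exp_add]; ring_nf
    _ ≤ 3 ^ m * Real.exp (-(m / 2)) := by gcongr

theorem le_log_zkExp_Bmap {k r : ℕ} (hk : 0 < k) (hr : 16 ^ 3 ≤ r) :
    (r : ℝ) ^ (1 / 3 : ℝ) / 32 ≤ Real.log (zkExp (k * r) k fun g => (Bmap g : ℝ)) := by
  set t := (r : ℝ) ^ (1 / 3 : ℝ) with ht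
  have ht0 : 0 ≤ t := by positivity
  have ht3 : t ^ 3 = r := by
    rw [ht, ← Real.rpow_natCast, ← Real.rpow_mul (Nat.cast_nonneg r)]
    norm_num
  have ht16 : 16 ≤ t := by
    refine le_of_pow_le_pow_left₀ three_ne_zero ht0 ?_
    rw [ht3]
    exact_mod_cast hr
  set m := ⌊t / 8⌋₊
  have hm₁ : (m : ℝ) ≤ t / 8 := Nat.floor_le (by positivity)
  have hm₂ : t / 8 < m + 1 := Nat.lt_floor_add_one _
  have hm : 1 ≤ m := by
    rw [Nat.one_le_iff_ne_zero]
    intro h0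
    rw [h0] at hm₂
    norm_num at hm₂
    linarith
  have h8 : (8 * m) ^ 3 ≤ r := by
    have : ((8 : ℝ) * m) ^ 3 ≤ r := by
      rw [← ht3]
      gcongr
      linarith
    exact_mod_cast this
  have := Real.log_le_log (Real.exp_pos _) (exp_half_le_zkExp_Bmap hk hm h8)
  rw [Real.log_exp] at this
  linarith

/-- Exponential tail bound for the number of cycles. -/
theorem zkProb_le_of_le_Cmap {n k : ℕ} {p : (Fin n → Fin n) → Prop} {M : ℝ}
    (h : ∀ f, p f → M ≤ Cmap f) :
    zkProb n k p ≤ (n + 1) * Real.exp (-(Real.log 2 * M)) := by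
  rw [zkProb]
  refine div_le_of_le_mul₀ (Nat.cast_nonneg _) (by positivity) ?_
  rw [Real.exp_neg, mul_right_comm, ← div_eq_mul_inv, le_div_iff₀ (Real.exp_pos _)]
  refine le_trans ?_ (sum_two_pow_Cmap_le n k)
  calc (((zkMaps n k).filter p).card : ℝ) * Real.exp (Real.log 2 * M)
      = ∑ f ∈ (zkMaps n k).filter p, Real.exp (Real.log 2 * M) := by
        rw [sum_const, nsmul_eq_mul]
    _ ≤ ∑ f ∈ (zkMaps n k).filter p, (2 : ℝ) ^ Cmap f := by
        refine sum_le_sum fun f hf => ?_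
        rw [← Real.rpow_natCast, Real.rpow_def_of_pos two_pos, Real.exp_le_exp]
        exact mul_le_mul_of_nonneg_left (h f (mem_filter.1 hf).2) (Real.log_pos one_lt_two).le
    _ ≤ ∑ f ∈ zkMaps n k, (2 : ℝ) ^ Cmap f :=
        sum_le_sum_of_subset_of_nonneg (filter_subset _ _) fun _ _ _ => by positivity

theorem le_Cmap_of_rpow_le {n : ℕ} {f : Fin n → Fin n} {E β s : ℝ} (hn : 1 < n)
    (hβ : (Real.log n ^ 2)⁻¹ ≤ β) (hE : 0 < E) (hs : 0 ≤ s) (hsE : s ≤ Real.log E)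
    (hB : E ^ β ≤ Bmap f) : s / Real.log n ^ 3 ≤ Cmap f := by
  have hlog : 0 < Real.log n := Real.log_pos (by exact_mod_cast hn)
  have h₁ := Real.log_le_log (Real.rpow_pos_of_pos hE β)
    (hB.trans (show (Bmap f : ℝ) ≤ (n : ℝ) ^ Cmap f by exact_mod_cast Bmap_le_pow f))
  rw [Real.log_rpow hE, Real.log_pow] at h₁
  have h₂ : (Real.log n ^ 2)⁻¹ * s ≤ Cmap f * Real.log n :=
    (mul_le_mul hβ hsE hs ((inv_nonneg.2 (sq_nonneg _)).trans hβ)).trans h₁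
  rw [inv_mul_le_iff₀ (by positivity)] at h₂
  rw [div_le_iff₀ (by positivity)]
  linarith

/-- Comparison of the rates expressed through `x` and through `x / λ`. -/
theorem eventually_rate_bounds (K c : ℝ) (hK : 1 ≤ K) (hc : 0 < c) :
    ∀ᶠ a : ℝ in atTop, ∀ x, a ≤ x → x ≤ K * a →
      a ^ (1 / 3 : ℝ) / Real.log a ^ 3 ≤ 8 * (x ^ (1 / 3 : ℝ) / Real.log x ^ 3) ∧
      x + 1 < Real.exp (c * (a ^ (1 / 3 : ℝ) / Real.log a ^ 3)) := by
  have hlit := (isLittleO_log_rpow_rpow_atTop (4 : ℕ) (show (0 : ℝ) < 1 / 3 by norm_num)).def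
    (show (0 : ℝ) < c / 3 by positivity)
  filter_upwards [hlit, eventually_ge_atTop (K + 1), eventually_ge_atTop 2]
    with a ha haK ha2 x hax hxK
  have hx0 : 0 < x := by linarith
  have hla : 0 < Real.log a := Real.log_pos (by linarith)
  have hlx : 0 < Real.log x := Real.log_pos (by linarith)
  have hxa2 : x + 1 ≤ a ^ 2 := by nlinarith
  have hlx2 : Real.log x ≤ 2 * Real.log a := by
    have := Real.log_le_log (by linarith) (show x ≤ a ^ 2 by linarith)
    rwa [Real.log_pow, Nat.cast_ofNat] at this
  refine ⟨?_, ?_⟩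
  · rw [← mul_div_assoc, div_le_div_iff₀ (by positivity) (by positivity)]
    have h₁ : a ^ (1 / 3 : ℝ) ≤ x ^ (1 / 3 : ℝ) :=
      Real.rpow_le_rpow (by linarith) hax (by norm_num)
    have h₂ : Real.log x ^ 3 ≤ 8 * Real.log a ^ 3 :=
      (pow_le_pow_left₀ hlx.le hlx2 3).trans_eq (by ring)
    calc a ^ (1 / 3 : ℝ) * Real.log x ^ 3 ≤ x ^ (1 / 3 : ℝ) * (8 * Real.log a ^ 3) := by gcongr
      _ = 8 * x ^ (1 / 3 : ℝ) * Real.log a ^ 3 := by ring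
  · have hx1 : Real.log (x + 1) ≤ 2 * Real.log a := by
      have := Real.log_le_log (by linarith) hxa2
      rwa [Real.log_pow, Nat.cast_ofNat] at this
    rw [← Real.log_lt_iff_lt_exp (by linarith)]
    rw [Real.rpow_natCast, Real.norm_of_nonneg (by positivity),
      Real.norm_of_nonneg (by positivity)] at ha
    have h3 : 3 * Real.log a ≤ c * (a ^ (1 / 3 : ℝ) / Real.log a ^ 3) := by
      rw [← mul_div_assoc, le_div_iff₀ (by positivity)]
      linarith
    linarith

/-- the probability that a uniform `{0,k}`-mapping has
`B ≥ (E_n(B))^b` is exponentially small, so the expected number of samples needed to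
find such a mapping is exponentially large. -/
theorem stmt_19 (k : ℕ) (hk : 2 ≤ k) (b : ℕ → ℝ) (hb : ∀ r, 0 < b r)
    (hbo : Tendsto
      (fun r : ℕ => (b r)⁻¹ * (Real.log ((k * r : ℕ) : ℝ)) ^ (-(2 : ℝ)))
      atTop (nhds 0))
    (ξ P D : ℕ → ℝ)
    (hξ : ∀ r, ξ r = (zkExp (k * r) k (fun g => (Bmap g : ℝ))) ^ (b r))
    (hP : ∀ r, P r = zkProb (k * r) k (fun f => ξ r ≤ (Bmap f : ℝ)))
    (hD : ∀ r, D r = (((k * r : ℕ) : ℝ) / ((k : ℝ) - 1)) ^ ((1 : ℝ) / 3) /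
      (Real.log (((k * r : ℕ) : ℝ) / ((k : ℝ) - 1))) ^ 3) :
    ∃ c₁ c₂ : ℝ, 0 < c₁ ∧ 0 < c₂ ∧
      ∀ᶠ r : ℕ in atTop,
        P r < Real.exp (-(c₁ * D r)) ∧
        Real.exp (c₁ * D r) * P r < 1 ∧
        Real.exp (c₂ * D r) * P r ≤ Real.exp (-(c₂ * D r)) := by
  have hk0 : 0 < k := by omega
  have hkR : (2 : ℝ) ≤ k := by exact_mod_cast hk
  have hlam : (0 : ℝ) < (k : ℝ) - 1 := by linarith
  set c : ℝ := Real.log 2 / (256 * (k : ℝ) ^ (1 / 3 : ℝ)) with hc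
  have hc0 : 0 < c := div_pos (Real.log_pos one_lt_two) (by positivity)
  have hatop : Tendsto (fun r : ℕ => ((k * r : ℕ) : ℝ) / ((k : ℝ) - 1)) atTop atTop := by
    refine (tendsto_natCast_atTop_atTop (R := ℝ)).comp ?_ |>.atTop_div_const hlam
    exact tendsto_id.const_mul_atTop' hk0
  have hrate := hatop.eventually (eventually_rate_bounds ((k : ℝ) - 1 + 1) (c / 2) (by linarith)
    (by positivity))
  have key : ∀ᶠ r : ℕ in atTop, 0 ≤ D r ∧ P r < Real.exp (-(c / 2 * D r)) := by
    filter_upwards [hrate, hbo.eventually_le_const one_pos, hatop.eventually_ge_atTop 1,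
      eventually_ge_atTop (16 ^ 3)] with r hr hbr har hr16
    have hn : 1 < k * r := by nlinarith
    set x : ℝ := ((k * r : ℕ) : ℝ) with hx
    have hx1 : 1 < x := by rw [hx]; exact_mod_cast hn
    have hlx : 0 < Real.log x := Real.log_pos hx1
    obtain ⟨h₁, h₂⟩ := hr x (by rw [div_le_iff₀ hlam]; nlinarith)
      (by rw [mul_div_assoc', le_div_iff₀ hlam]; nlinarith)
    rw [← hD r] at h₁ h₂
    have hD0 : 0 ≤ D r := by
      rw [hD r]
      have := Real.log_nonneg har
      positivity
    refine ⟨hD0, ?_⟩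
    have hβ : (Real.log x ^ 2)⁻¹ ≤ b r := by
      rw [Real.rpow_neg hlx.le, Real.rpow_two, inv_mul_le_iff₀ (hb r), mul_one] at hbr
      exact hbr
    set E := zkExp (k * r) k fun g => (Bmap g : ℝ) with hEdef
    have hlog := le_log_zkExp_Bmap hk0 hr16
    rw [← hEdef] at hlog
    have hE : 0 < E := by
      have hE0 : 0 ≤ E := div_nonneg (sum_nonneg fun _ _ => Nat.cast_nonneg _) (Nat.cast_nonneg _)
      refine hE0.lt_of_ne fun h0 => ?_
      rw [← h0, Real.log_zero] at hlog
      have : (0 : ℝ) < (r : ℝ) ^ (1 / 3 : ℝ) := Real.rpow_pos_of_pos (by norm_cast; omega) _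
      linarith
    have hPle : P r ≤ (x + 1) *
        Real.exp (-(Real.log 2 * ((r : ℝ) ^ (1 / 3 : ℝ) / 32 / Real.log x ^ 3))) := by
      rw [hP r]
      refine zkProb_le_of_le_Cmap fun f hf => ?_
      exact le_Cmap_of_rpow_le hn hβ hE (by positivity) hlog (by rwa [hξ r] at hf)
    have hcD : c * D r ≤ Real.log 2 * ((r : ℝ) ^ (1 / 3 : ℝ) / 32 / Real.log x ^ 3) := by
      refine (mul_le_mul_of_nonneg_left h₁ hc0.le).trans_eq ?_
      rw [hc, hx, Nat.cast_mul, Real.mul_rpow (Nat.cast_nonneg k) (Nat.cast_nonneg r)]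
      field_simp
      norm_num
    calc P r ≤ (x + 1) * Real.exp (-(c * D r)) := by
          refine hPle.trans ?_
          gcongr
      _ < Real.exp (c / 2 * D r) * Real.exp (-(c * D r)) := by gcongr
      _ = Real.exp (-(c / 2 * D r)) := by rw [← Real.exp_add]; ring_nf
  refine ⟨c / 4, c / 4, by positivity, by positivity, ?_⟩
  filter_upwards [key] with r hr
  obtain ⟨hD0, hPr⟩ := hr
  have h₁ : Real.exp (c / 4 * D r) * P r ≤ Real.exp (-(c / 4 * D r)) := by
    calc Real.exp (c / 4 * D r) * P r ≤ Real.exp (c / 4 * D r) * Real.exp (-(c / 2 * D r)) := by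
          gcongr
      _ = Real.exp (-(c / 4 * D r)) := by rw [← Real.exp_add]; ring_nf
  refine ⟨hPr.trans_le (Real.exp_le_exp.2 (by nlinarith)), ?_, h₁⟩
  calc Real.exp (c / 4 * D r) * P r < Real.exp (c / 4 * D r) * Real.exp (-(c / 2 * D r)) := by
        gcongr
    _ = Real.exp (-(c / 4 * D r)) := by rw [← Real.exp_add]; ring_nf
    _ ≤ 1 := Real.exp_le_one_iff.2 (by nlinarith)
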